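/- Let n ≥ 3 be odd and G a nonbipartite 2-connected graph of order n. Then q(C_n) ≤ q(G), where C_n is the cycle of order n. -/

import Mathlib

open Matrix SimpleGraph
open scoped Classical

/-- The signless Laplacian matrix `Q(G) = D(G) + A(G)` of a simple graph. -/
noncomputable def signlessLaplacian {V : Type*} [Fintype V] (G : SimpleGraph V) :
    Matrix V V ℝ := fun i j =>
  (if i = j then ((G.neighborSet i).ncard : ℝ) else 0) + (if G.Adj i j then 1 else 0)

/-- The least eigenvalue `q(G)` of the signless Laplacian of `G`. -/
noncomputable def leastQEig {V : Type*} [Fintype V] (G : SimpleGraph V) : ℝ :=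
  sInf {μ : ℝ | ∃ x : V → ℝ, x ≠ 0 ∧ (signlessLaplacian G).mulVec x = μ • x}

/-- A graph is 2-connected if it has at least 3 vertices and no cut vertex. -/
def TwoConnected {V : Type*} [Fintype V] (G : SimpleGraph V) : Prop :=
  3 ≤ Fintype.card V ∧
    ∀ v : V, (((⊤ : G.Subgraph).deleteVerts {v}).coe).Connected

/-- The cycle `C_n` on vertices `v_0, …, v_{n-1}`. -/
def cycleG (n : ℕ) : SimpleGraph (Fin n) :=
  SimpleGraph.fromRel (fun i j => (i.val + 1) % n = j.val)

/-- `H(i₁,…,i_k)`: the cycle `C_n` together with the chords `v_i v_{n-i}` for `i ∈ S`. -/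
def Hgraph (n : ℕ) (S : Finset ℕ) : SimpleGraph (Fin n) :=
  cycleG n ⊔ SimpleGraph.fromRel (fun a b => ∃ i ∈ S, a.val = i ∧ b.val = n - i)

/-- `Θ(j,k)`: the odd cycle `v₁v₂⋯v_{n-1}v₁` plus a vertex `v₀` adjacent to `v_j` and `v_k`. -/
def thetaJK (n j k : ℕ) : SimpleGraph (Fin n) :=
  SimpleGraph.fromRel (fun a b =>
    (1 ≤ a.val ∧ b.val = a.val + 1) ∨ (a.val = 1 ∧ b.val = n - 1) ∨
      (a.val = 0 ∧ (b.val = j ∨ b.val = k)))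

/-- The graph `Θ = Θ(2, n-1)`. -/
def thetaG (n : ℕ) : SimpleGraph (Fin n) := thetaJK n 2 (n - 1)

lemma tele (a : ℕ → ℝ) (n u : ℕ) :
    ∑ i ∈ Finset.range n, (if u ≤ i then (1:ℝ) else 0) * (a i - a (i+1)) =
      if u ≤ n then a u - a n else 0 := by
  induction n with
  | zero => 
    by_cases h : u = 0
    · simp [h]
    · simp [h]
  | succ n ih =>
    rw [Finset.sum_range_succ, ih]
    by_cases h : u ≤ n
    · rw [if_pos h, if_pos h, if_pos (by omega)]; ring
    · rw [if_neg h, if_neg h]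
      by_cases h' : u = n + 1
      · subst h'; simp
      · rw [if_neg (by omega)]; ring

noncomputable def Mco (k i j : ℕ) : ℝ :=
  (if j = i then (if i = k+1 then 4 else 2) else 0) + (if j = i + 1 then (if i = k then 2 else 1) else 0)
   + (if i = j + 1 then (if j = k then 2 else 1) else 0)

lemma target_eq (k : ℕ) (d : ℕ → ℝ) :
    ∑ i ∈ Finset.range (k+2), ∑ j ∈ Finset.range (k+2), d i * d j * Mco k i j =
      d 0 ^ 2 + ∑ i ∈ Finset.range k, (d i + d (i+1))^2 + (d k + 2 * d (k+1))^2 := by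
  have e1 : ∑ i ∈ Finset.range (k+2), ∑ j ∈ Finset.range (k+2),
      d i * d j * (if j = i then (if i = k+1 then 4 else 2) else 0) =
      2 * ∑ i ∈ Finset.range (k+1), d i ^ 2 + 4 * d (k+1)^2 := by
    have : ∀ i ∈ Finset.range (k+2), ∑ j ∈ Finset.range (k+2),
      d i * d j * (if j = i then (if i = k+1 then 4 else 2) else 0) =
        d i ^ 2 * (if i = k+1 then 4 else 2) := by
      intro i hi
      rw [Finset.sum_eq_single_of_mem i hi]
      · simp [sq]
      · intro b _ hb; simp [hb]
    rw [Finset.sum_congr rfl this, Finset.sum_range_succ, Finset.mul_sum]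
    congr 1
    · apply Finset.sum_congr rfl
      intro i hi
      rw [Finset.mem_range] at hi
      rw [if_neg (by omega)]; ring
    · rw [if_pos rfl]; ring
  have e2 : ∑ i ∈ Finset.range (k+2), ∑ j ∈ Finset.range (k+2),
      d i * d j * (if j = i + 1 then (if i = k then 2 else 1) else 0) =
      ∑ i ∈ Finset.range k, d i * d (i+1) + 2 * (d k * d (k+1)) := by
    rw [Finset.sum_range_succ]
    have : ∀ i ∈ Finset.range (k+1), ∑ j ∈ Finset.range (k+2),
      d i * d j * (if j = i + 1 then (if i = k then 2 else 1) else 0) =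
        d i * d (i+1) * (if i = k then 2 else 1) := by
      intro i hi
      rw [Finset.mem_range] at hi
      rw [Finset.sum_eq_single_of_mem (i+1) (by rw [Finset.mem_range]; omega)]
      · simp
      · intro b _ hb; simp [hb]
    have h0 : ∑ j ∈ Finset.range (k+2),
      d (k+1) * d j * (if j = k + 1 + 1 then (if k+1 = k then (2:ℝ) else 1) else 0) = 0 := by
      apply Finset.sum_eq_zero
      intro j hj
      rw [Finset.mem_range] at hj
      rw [if_neg (by omega)]; ring
    rw [Finset.sum_congr rfl this, h0, Finset.sum_range_succ, if_pos rfl]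
    have : ∀ i ∈ Finset.range k, d i * d (i+1) * (if i = k then 2 else 1) = d i * d (i+1) := by
      intro i hi
      rw [Finset.mem_range] at hi
      rw [if_neg (by omega)]; ring
    rw [Finset.sum_congr rfl this]; ring
  have e3 : ∑ i ∈ Finset.range (k+2), ∑ j ∈ Finset.range (k+2),
      d i * d j * (if i = j + 1 then (if j = k then 2 else 1) else 0) =
      ∑ i ∈ Finset.range k, d i * d (i+1) + 2 * (d k * d (k+1)) := by
    rw [← e2, Finset.sum_comm]
    refine Finset.sum_congr rfl fun i _ => Finset.sum_congr rfl fun j _ => ?_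
    ring
  simp only [Mco, mul_add, Finset.sum_add_distrib]
  rw [e1, e2, e3]
  have e4 : ∑ i ∈ Finset.range k, (d i + d (i+1))^2 = ∑ i ∈ Finset.range k, d i ^ 2
      + ∑ i ∈ Finset.range k, d (i+1) ^ 2 + 2 * ∑ i ∈ Finset.range k, d i * d (i+1) := by
    rw [Finset.mul_sum, ← Finset.sum_add_distrib, ← Finset.sum_add_distrib]
    exact Finset.sum_congr rfl fun i _ => by ring
  have e5 := Finset.sum_range_succ (fun i => d i ^ 2) k
  have e6 := Finset.sum_range_succ' (fun i => d i ^ 2) k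
  rw [e4]
  linarith

noncomputable def cc (ε : ℕ → ℝ) (e : ℕ × ℕ) (i : ℕ) : ℝ :=
  ε e.1 * (if e.1 ≤ i then 1 else 0) + ε e.2 * (if e.2 ≤ i then 1 else 0)

lemma cc_nonneg (ε : ℕ → ℝ) (hε : ∀ i, ε i = 1 ∨ ε i = -1) (e : ℕ × ℕ) (i j : ℕ) :
    0 ≤ cc ε e i * cc ε e j := by
  unfold cc
  rcases hε e.1 with h1 | h1 <;> rcases hε e.2 with h2 | h2 <;> rw [h1, h2] <;>
    split_ifs <;> first | omega | norm_num

lemma core (k : ℕ) (E : Finset (ℕ × ℕ)) (ε a : ℕ → ℝ) (hε : ∀ i, ε i = 1 ∨ ε i = -1)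
    (ha : ∀ i, a (i+1) ≤ a i) (han : a (k+2) = 0)
    (hE : ∀ e ∈ E, e.1 < k+2 ∧ e.2 < k+2)
    (h1 : ∀ i ≤ k, ∃ e ∈ E, ∃ f ∈ E, e ≠ f ∧ e.1 ≤ i ∧ i < e.2 ∧ f.1 ≤ i ∧ i < f.2)
    (h2 : ∀ i < k, ∃ e ∈ E, e.1 ≤ i ∧ i + 1 < e.2)
    (h3 : ∃ e ∈ E, e.1 < e.2 ∧ ε e.1 = ε e.2) :
    (a 0 - a 1)^2 + ∑ i ∈ Finset.range k, (a i - a (i+2))^2 + (a k + a (k+1))^2 ≤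
      ∑ e ∈ E, (ε e.1 * a e.1 + ε e.2 * a e.2)^2 := by
  set d : ℕ → ℝ := fun i => a i - a (i+1) with hd
  have hd0 : ∀ i, 0 ≤ d i := fun i => by have := ha i; simp only [hd]; linarith
  have hT : (a 0 - a 1)^2 + ∑ i ∈ Finset.range k, (a i - a (i+2))^2 + (a k + a (k+1))^2 =
      ∑ i ∈ Finset.range (k+2), ∑ j ∈ Finset.range (k+2), d i * d j * Mco k i j := by
    rw [target_eq]
    simp only [hd]
    congr 1
    · congr 1
      exact Finset.sum_congr rfl fun i _ => by ring
    · rw [show k + 1 + 1 = k + 2 from rfl, han]; ring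
  have hL : ∀ e ∈ E, (ε e.1 * a e.1 + ε e.2 * a e.2)^2 =
      ∑ i ∈ Finset.range (k+2), ∑ j ∈ Finset.range (k+2), d i * d j * (cc ε e i * cc ε e j) := by
    intro e he
    have t1 := tele a (k+2) e.1
    have t2 := tele a (k+2) e.2
    rw [if_pos (hE e he).1.le, han, sub_zero] at t1
    rw [if_pos (hE e he).2.le, han, sub_zero] at t2
    have : ε e.1 * a e.1 + ε e.2 * a e.2 = ∑ i ∈ Finset.range (k+2), d i * cc ε e i := by
      rw [← t1, ← t2, Finset.mul_sum, Finset.mul_sum, ← Finset.sum_add_distrib]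
      exact Finset.sum_congr rfl fun i _ => by simp only [cc, hd]; ring
    rw [this, sq, Finset.sum_mul_sum]
    exact Finset.sum_congr rfl fun i _ => Finset.sum_congr rfl fun j _ => by ring
  have hR : ∑ e ∈ E, ∑ i ∈ Finset.range (k+2), ∑ j ∈ Finset.range (k+2),
      d i * d j * (cc ε e i * cc ε e j) = ∑ i ∈ Finset.range (k+2), ∑ j ∈ Finset.range (k+2),
      d i * d j * ∑ e ∈ E, cc ε e i * cc ε e j := by
    rw [Finset.sum_comm]
    refine Finset.sum_congr rfl fun i _ => ?_
    rw [Finset.sum_comm]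
    refine Finset.sum_congr rfl fun j _ => ?_
    rw [Finset.mul_sum]
  rw [hT, Finset.sum_congr rfl hL, hR]
  refine Finset.sum_le_sum fun i hi => ?_
  refine Finset.sum_le_sum fun j hj => ?_
  refine mul_le_mul_of_nonneg_left ?_ (mul_nonneg (hd0 i) (hd0 j))
  rw [Finset.mem_range] at hi hj
  have nn := fun e (_ : e ∈ E) => cc_nonneg ε hε e i j
  have one : ∀ e ∈ E, ∀ r : ℝ, r ≤ cc ε e i * cc ε e j → r ≤ ∑ e ∈ E, cc ε e i * cc ε e j :=
    fun e he r hr => hr.trans (Finset.single_le_sum nn he)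
  have sq1 : ∀ p, ε p * ε p = 1 := by
    intro p; rcases hε p with h | h <;> rw [h] <;> norm_num
  -- cases
  obtain ⟨g, hg, hg12, hgε⟩ := h3
  obtain ⟨hg1, hg2⟩ := hE g hg
  have hsq := sq1 g.2
  by_cases hij : j = i
  · subst hij
    have hM : Mco k j j = if j = k+1 then 4 else 2 := by simp [Mco]
    rw [hM]
    split_ifs with hk
    · apply one g hg
      unfold cc
      rw [if_pos (by omega), if_pos (by omega), hgε]
      nlinarith
    · obtain ⟨e, he, f, hf, hef, he1, he2, hf1, hf2⟩ := h1 j (by omega)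
      have hs : ∑ e ∈ ({e, f} : Finset (ℕ × ℕ)), cc ε e j * cc ε e j ≤ ∑ e ∈ E, cc ε e j * cc ε e j := by
        apply Finset.sum_le_sum_of_subset_of_nonneg
        · intro x hx
          simp at hx
          rcases hx with rfl | rfl <;> assumption
        · intro x hx _; exact nn x hx
      rw [Finset.sum_pair hef] at hs
      refine le_trans ?_ hs
      unfold cc
      rw [if_pos he1, if_neg (by omega), if_pos hf1, if_neg (by omega)]
      have := sq1 e.1
      have := sq1 f.1
      nlinarith
  have adjc : ∀ p, p < k + 1 → (if p = k then (2:ℝ) else 1) ≤ ∑ e ∈ E, cc ε e p * cc ε e (p+1) := by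
    intro p hp
    have nn := fun e (_ : e ∈ E) => cc_nonneg ε hε e p (p+1)
    split_ifs with hk
    · refine le_trans ?_ (Finset.single_le_sum nn hg)
      unfold cc
      rw [hgε]
      split_ifs <;> first | omega | nlinarith
    · obtain ⟨e, he, he1, he2⟩ := h2 p (by omega)
      refine le_trans ?_ (Finset.single_le_sum nn he)
      unfold cc
      rw [if_pos (by omega), if_neg (by omega), if_pos (by omega), if_neg (by omega)]
      have := sq1 e.1
      nlinarith
  by_cases hj1 : j = i + 1
  · subst hj1
    have hM : Mco k i (i+1) = if i = k then 2 else 1 := by simp [Mco]; omega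
    rw [hM]
    exact adjc i (by omega)
  by_cases hi1 : i = j + 1
  · subst hi1
    have hM : Mco k (j+1) j = if j = k then 2 else 1 := by simp [Mco]; omega
    rw [hM]
    refine (adjc j (by omega)).trans (le_of_eq ?_)
    exact Finset.sum_congr rfl fun i _ => by ring
  · have hM : Mco k i j = 0 := by simp [Mco, hij, hj1, hi1]
    rw [hM]
    exact Finset.sum_nonneg nn

lemma quadQ {V : Type*} [Fintype V] (G : SimpleGraph V) (x : V → ℝ) :
    x ⬝ᵥ (signlessLaplacian G).mulVec x =
      (1/2) * ∑ u, ∑ v, if G.Adj u v then (x u + x v)^2 else 0 := by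
  have hdeg : ∀ u, ((G.neighborSet u).ncard : ℝ) = ∑ v, if G.Adj u v then (1:ℝ) else 0 := by
    intro u
    rw [Finset.sum_boole, Set.ncard_eq_toFinset_card']
    congr 2
    ext v; simp
  have e1 : x ⬝ᵥ (signlessLaplacian G).mulVec x =
      ∑ u, ∑ v, (if G.Adj u v then (x u ^ 2 + x u * x v) else 0) := by
    simp only [dotProduct, Matrix.mulVec, signlessLaplacian, add_mul, Finset.sum_add_distrib]
    refine Finset.sum_congr rfl fun u _ => ?_
    have : ∑ v, (if u = v then ((G.neighborSet u).ncard : ℝ) else 0) * x v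
        = (∑ v, if G.Adj u v then (1:ℝ) else 0) * x u := by
      simp [hdeg]
    rw [this, Finset.sum_mul, ← Finset.sum_add_distrib, Finset.mul_sum]
    refine Finset.sum_congr rfl fun v _ => ?_
    split_ifs <;> ring
  have e2 : ∑ u, ∑ v, (if G.Adj u v then (x u ^ 2 + x u * x v) else 0) =
      ∑ u, ∑ v, (if G.Adj u v then (x v ^ 2 + x u * x v) else 0) := by
    rw [Finset.sum_comm]
    refine Finset.sum_congr rfl fun u _ => Finset.sum_congr rfl fun v _ => ?_
    simp only [G.adj_comm v u, mul_comm (x v)]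
  have e3 : ∑ u, ∑ v, (if G.Adj u v then (x u + x v)^2 else 0) =
     ∑ u, ∑ v, (if G.Adj u v then (x u ^ 2 + x u * x v) else 0) +
      ∑ u, ∑ v, (if G.Adj u v then (x v ^ 2 + x u * x v) else 0) := by
    rw [← Finset.sum_add_distrib]
    refine Finset.sum_congr rfl fun u _ => ?_
    rw [← Finset.sum_add_distrib]
    refine Finset.sum_congr rfl fun v _ => ?_
    split_ifs <;> ring
  rw [e3, ← e2, e1]; ring

lemma quadQ_nonneg {V : Type*} [Fintype V] (G : SimpleGraph V) (x : V → ℝ) :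
    0 ≤ x ⬝ᵥ (signlessLaplacian G).mulVec x := by
  rw [quadQ]
  refine mul_nonneg (by norm_num) (Finset.sum_nonneg fun u _ => Finset.sum_nonneg fun v _ => ?_)
  split_ifs <;> positivity

lemma dot_pos {V : Type*} [Fintype V] (x : V → ℝ) (hx : x ≠ 0) : 0 < x ⬝ᵥ x := by
  have h0 : 0 ≤ x ⬝ᵥ x := Finset.sum_nonneg fun i _ => mul_self_nonneg _
  refine lt_of_le_of_ne h0 fun h => hx (dotProduct_self_eq_zero.1 h.symm)

lemma sym_Q {V : Type*} [Fintype V] (G : SimpleGraph V) : (signlessLaplacian G).IsHermitian := by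
  ext i j
  simp only [Matrix.conjTranspose_apply, signlessLaplacian, star_trivial, G.adj_comm j i]
  congr 1
  by_cases h : i = j
  · subst h; rfl
  · rw [if_neg h, if_neg (Ne.symm h)]

lemma bdd_Q {V : Type*} [Fintype V] (G : SimpleGraph V) :
    BddBelow {μ : ℝ | ∃ x : V → ℝ, x ≠ 0 ∧ (signlessLaplacian G).mulVec x = μ • x} := by
  refine ⟨0, ?_⟩
  rintro μ ⟨x, hx, h⟩
  have := quadQ_nonneg G x
  rw [h, dotProduct_smul, smul_eq_mul] at this
  have := dot_pos x hx
  by_contra! hc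
  nlinarith

lemma rayleigh {V : Type*} [Fintype V] (G : SimpleGraph V) (x : V → ℝ) :
    leastQEig G * (x ⬝ᵥ x) ≤ x ⬝ᵥ (signlessLaplacian G).mulVec x := by
  set q := leastQEig G
  have hM : (signlessLaplacian G - q • (1 : Matrix V V ℝ)).IsHermitian := by
    apply (sym_Q G).sub
    ext i j
    simp [Matrix.one_apply, eq_comm]
  have hp : (signlessLaplacian G - q • (1 : Matrix V V ℝ)).PosSemidef := by
    rw [hM.posSemidef_iff_eigenvalues_nonneg]
    intro i
    have h1 := hM.mulVec_eigenvectorBasis i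
    have h2 : (signlessLaplacian G).mulVec (hM.eigenvectorBasis i).ofLp =
        (hM.eigenvalues i + q) • (hM.eigenvectorBasis i).ofLp := by
      rw [Matrix.sub_mulVec, Matrix.smul_mulVec, Matrix.one_mulVec] at h1
      rw [add_smul, ← h1]; simp
    have h3 : q ≤ hM.eigenvalues i + q := by
      apply csInf_le (bdd_Q G)
      refine ⟨_, ?_, h2⟩
      intro h
      have := hM.eigenvectorBasis.orthonormal.ne_zero i
      apply this
      ext j
      exact congrFun h j
    simpa using h3
  have := hp.dotProduct_mulVec_nonneg x
  simp only [star_trivial] at this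
  rw [Matrix.sub_mulVec, Matrix.smul_mulVec, Matrix.one_mulVec, dotProduct_sub, dotProduct_smul,
    smul_eq_mul] at this
  linarith

lemma nonempty_Q {V : Type*} [Fintype V] [Nonempty V] (G : SimpleGraph V) :
    {μ : ℝ | ∃ x : V → ℝ, x ≠ 0 ∧ (signlessLaplacian G).mulVec x = μ • x}.Nonempty := by
  have hM := sym_Q G
  let i : V := Classical.arbitrary V
  refine ⟨hM.eigenvalues i, _, ?_, hM.mulVec_eigenvectorBasis i⟩
  intro h
  have := hM.eigenvectorBasis.orthonormal.ne_zero i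
  apply this
  ext j
  exact congrFun h j

lemma cutv {V : Type*} [Fintype V] (G : SimpleGraph V) (h2 : TwoConnected G) (v : V) (S : Set V)
    (hvS : v ∉ S) (a b : V) (ha : a ∈ S) (hb : b ∉ S) (hbv : b ≠ v) :
    ∃ u ∈ S, ∃ w, w ∉ S ∧ w ≠ v ∧ G.Adj u w := by
  have hav : a ≠ v := fun h => hvS (h ▸ ha)
  have hc := h2.2 v
  obtain ⟨p⟩ := hc.preconnected ⟨a, by simp [hav]⟩ ⟨b, by simp [hbv]⟩
  obtain ⟨d, _, h1, h3⟩ := p.exists_boundary_dart {z | (z : V) ∈ S} ha hb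
  refine ⟨d.fst, h1, d.snd, h3, ?_, ?_⟩
  · have := d.snd.2
    simp at this
    exact this
  · have := d.adj
    simp at this
    tauto

lemma cycle_form (n : ℕ) (hn : 3 ≤ n) (w : ℕ → ℝ) (hw : w n = w 0) :
    (1/2) * ∑ u : Fin n, ∑ v : Fin n, (if (cycleG n).Adj u v then (w u + w v)^2 else 0) ≤
      ∑ p ∈ Finset.range n, (w p + w (p+1))^2 := by
  have hmod : ∀ u : Fin n, w ((u.val+1) % n) = w (u.val + 1) := by
    intro u
    rcases Nat.lt_or_ge (u.val+1) n with h | h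
    · rw [Nat.mod_eq_of_lt h]
    · have : u.val + 1 = n := by omega
      rw [this, Nat.mod_self, hw]
  have hA : ∑ u : Fin n, ∑ v : Fin n, (if (u.val+1) % n = v.val then (w u + w v)^2 else 0) =
      ∑ p ∈ Finset.range n, (w p + w (p+1))^2 := by
    rw [Finset.sum_range]
    refine Finset.sum_congr rfl fun u _ => ?_
    rw [Finset.sum_eq_single (⟨(u.val+1) % n, Nat.mod_lt _ (by omega)⟩ : Fin n)]
    · simp [hmod]
    · intro b _ hb
      rw [if_neg]
      intro h; apply hb; ext; simp [h]
    · simp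
  have hB : ∑ u : Fin n, ∑ v : Fin n, (if (v.val+1) % n = u.val then (w u + w v)^2 else 0) =
      ∑ p ∈ Finset.range n, (w p + w (p+1))^2 := by
    rw [← hA, Finset.sum_comm]
    refine Finset.sum_congr rfl fun u _ => Finset.sum_congr rfl fun v _ => ?_
    rw [add_comm (w v)]
  have : ∑ u : Fin n, ∑ v : Fin n, (if (cycleG n).Adj u v then (w u + w v)^2 else 0) ≤
     ∑ u : Fin n, ∑ v : Fin n, (if (u.val+1) % n = v.val then (w u + w v)^2 else 0) +
     ∑ u : Fin n, ∑ v : Fin n, (if (v.val+1) % n = u.val then (w u + w v)^2 else 0) := by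
    rw [← Finset.sum_add_distrib]
    refine Finset.sum_le_sum fun u _ => ?_
    rw [← Finset.sum_add_distrib]
    refine Finset.sum_le_sum fun v _ => ?_
    have := sq_nonneg (w u + w v)
    simp only [cycleG, SimpleGraph.fromRel_adj]
    split_ifs <;> first | tauto | linarith
  linarith

lemma split_odd (m : ℕ) (g : ℕ → ℝ) : ∑ i ∈ Finset.range (2*m+1), g i =
    g 0 + ∑ i ∈ Finset.range m, g (2*i+1) + ∑ i ∈ Finset.range m, g (2*i+2) := by
  induction m with
  | zero => simp
  | succ m ih =>
    rw [show 2*(m+1)+1 = 2*m+1+1+1 by ring, Finset.sum_range_succ, Finset.sum_range_succ, ih,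
      Finset.sum_range_succ, Finset.sum_range_succ]
    ring_nf

/-- The rearranged sequence around the cycle. -/
noncomputable def wseq (m : ℕ) (a : ℕ → ℝ) (p : ℕ) : ℝ :=
  if p = 0 then a 0 else if p ≤ m then (-1)^p * a (2*p-1) else (-1)^(p+1) * a (2*(2*m+1-p))

lemma wsum (m : ℕ) (a : ℕ → ℝ) :
    ∑ p ∈ Finset.range (2*m+1), wseq m a p ^ 2 = ∑ p ∈ Finset.range (2*m+1), a p ^ 2 := by
  rw [split_odd m fun p => a p ^ 2, Finset.sum_range_succ', show 2 * m = m + m by ring,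
    Finset.sum_range_add, ← Finset.sum_range_reflect (fun i => a (2*i+2)^2)]
  have h0 : wseq m a 0 = a 0 := by simp [wseq]
  have h1 : ∀ i ∈ Finset.range m, wseq m a (i+1) ^ 2 = a (2*i+1) ^ 2 := by
    intro i hi
    rw [Finset.mem_range] at hi
    simp only [wseq]
    rw [if_neg (by omega), if_pos (by omega), mul_pow, ← pow_mul, mul_comm (i+1) 2, pow_mul]
    simp
    congr 2
  have h2 : ∀ i ∈ Finset.range m, wseq m a (m+i+1) ^ 2 = a (2*(m-1-i)+2) ^ 2 := by
    intro i hi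
    rw [Finset.mem_range] at hi
    simp only [wseq]
    rw [if_neg (by omega), if_neg (by omega), mul_pow, ← pow_mul, mul_comm (m+i+1+1) 2, pow_mul]
    simp
    congr 2
    omega
  rw [Finset.sum_congr rfl h1, Finset.sum_congr rfl h2, h0]; ring

lemma wform (m : ℕ) (a : ℕ → ℝ) :
    ∑ p ∈ Finset.range (2*(m+1)+1), (wseq (m+1) a p + wseq (m+1) a (p+1)) ^ 2 =
    (a 0 - a 1)^2 + ∑ i ∈ Finset.range (2*m+1), (a i - a (i+2))^2 + (a (2*m+1) + a (2*m+2))^2 := by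
  rw [split_odd m, Finset.sum_range_succ', show 2 * (m+1) = (m + 1) + (m + 1) by ring,
    Finset.sum_range_add, Finset.sum_range_succ,
    ← Finset.sum_range_reflect (fun x => (wseq (m + 1) a (m + 1 + x + 1) +
      wseq (m + 1) a (m + 1 + x + 1 + 1)) ^ 2) (m+1),
    Finset.sum_range_succ' (fun j => (wseq (m + 1) a (m + 1 + (m + 1 - 1 - j) + 1) +
      wseq (m + 1) a (m + 1 + (m + 1 - 1 - j) + 1 + 1)) ^ 2) m]
  have hs : ∀ p : ℕ, ((-1:ℝ)^p)^2 = 1 := by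
    intro p; rw [← pow_mul, mul_comm, pow_mul]; simp
  have wl : ∀ p, 1 ≤ p → p ≤ m + 1 → wseq (m+1) a p = (-1)^p * a (2*p-1) := by
    intro p h1 h2
    simp only [wseq]
    rw [if_neg (by omega), if_pos h2]
  have wr : ∀ p, m + 1 < p → wseq (m+1) a p = (-1)^(p+1) * a (2*(2*(m+1)+1-p)) := by
    intro p h1
    simp only [wseq]
    rw [if_neg (by omega), if_neg (by omega)]
  have w0 : wseq (m+1) a 0 = a 0 := by simp [wseq]
  have e1 : ∀ x ∈ Finset.range m, (wseq (m + 1) a (x + 1) + wseq (m + 1) a (x + 1 + 1)) ^ 2 =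
      (a (2 * x + 1) - a (2 * x + 1 + 2)) ^ 2 := by
    intro x hx
    rw [Finset.mem_range] at hx
    rw [wl _ (by omega) (by omega), wl _ (by omega) (by omega),
      show 2 * (x+1) - 1 = 2 * x + 1 by omega, show 2 * (x+1+1) - 1 = 2 * x + 1 + 2 by omega,
      pow_succ _ (x+1)]
    linear_combination (a (2 * x + 1) - a (2 * x + 1 + 2)) ^ 2 * hs (x+1)
  have e2 : ∀ x ∈ Finset.range m, (wseq (m + 1) a (m + 1 + (m + 1 - 1 - (x+1)) + 1) +
      wseq (m + 1) a (m + 1 + (m + 1 - 1 - (x+1)) + 1 + 1)) ^ 2 =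
      (a (2 * x + 2) - a (2 * x + 2 + 2)) ^ 2 := by
    intro x hx
    rw [Finset.mem_range] at hx
    obtain ⟨y, hy⟩ : ∃ y, y = m + 1 + (m + 1 - 1 - (x+1)) + 1 := ⟨_, rfl⟩
    rw [← hy]
    rw [wr _ (by omega), wr _ (by omega),
      show 2*(2*(m+1)+1-y) = 2 * x + 2 + 2 by omega,
      show 2*(2*(m+1)+1-(y+1)) = 2 * x + 2 by omega,
      pow_succ _ (y+1)]
    linear_combination (a (2 * x + 2) - a (2 * x + 2 + 2)) ^ 2 * hs (y+1)
  have e3 : (wseq (m + 1) a (m + 1) + wseq (m + 1) a (m + 1 + 1)) ^ 2 =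
      (a (2*m+1) + a (2*m+2))^2 := by
    rw [wl _ (by omega) (by omega), wr _ (by omega), show 2 * (m+1) - 1 = 2 * m + 1 by omega,
      show 2*(2*(m+1)+1-(m+1+1)) = 2 * m + 2 by omega, pow_succ _ (m+1+1), pow_succ _ (m+1)]
    linear_combination (a (2*m+1) + a (2*m+2))^2 * hs (m+1)
  have e4 : (wseq (m + 1) a (m + 1 + (m + 1 - 1 - 0) + 1) +
      wseq (m + 1) a (m + 1 + (m + 1 - 1 - 0) + 1 + 1)) ^ 2 = (a 0 - a 2)^2 := by
    rw [show m + 1 + (m + 1 - 1 - 0) + 1 = 2 * (m+1) by omega, wr _ (by omega), wr _ (by omega),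
      show 2*(2*(m+1)+1-(2*(m+1))) = 2 by omega, show 2*(2*(m+1)+1-(2*(m+1)+1)) = 0 by omega,
      pow_succ _ (2*(m+1)+1)]
    linear_combination (a 0 - a 2)^2 * hs (2*(m+1)+1)
  have e5 : (wseq (m + 1) a 0 + wseq (m + 1) a (0+1)) ^ 2 = (a 0 - a 1)^2 := by
    rw [w0, wl _ (by omega) (by omega)]
    norm_num
    ring
  rw [Finset.sum_congr rfl e1, Finset.sum_congr rfl e2, e3, e4, e5]
  ring

lemma wper (m : ℕ) (a : ℕ → ℝ) : wseq m a (2*m+1) = wseq m a 0 := by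
  simp only [wseq]
  rw [if_neg (by omega), if_neg (by omega), if_pos trivial, show 2*m+1+1 = 2 * (m+1) by ring, pow_mul]
  simp

lemma half_sum (n : ℕ) (g : ℕ → ℕ → ℝ) (hs : ∀ i j, g i j = g j i) (h0 : ∀ i j, 0 ≤ g i j) :
    ∑ p ∈ (Finset.range n ×ˢ Finset.range n).filter (fun p => p.1 < p.2), g p.1 p.2 ≤
    (1/2) * ∑ i ∈ Finset.range n, ∑ j ∈ Finset.range n, g i j := by
  have h1 : ∑ i ∈ Finset.range n, ∑ j ∈ Finset.range n, (if i < j then g i j else 0) =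
      ∑ i ∈ Finset.range n, ∑ j ∈ Finset.range n, (if j < i then g i j else 0) := by
    rw [Finset.sum_comm]
    refine Finset.sum_congr rfl fun i _ => Finset.sum_congr rfl fun j _ => ?_
    rw [hs i j]
  have h2 : ∑ i ∈ Finset.range n, ∑ j ∈ Finset.range n, (if i < j then g i j else 0) +
      ∑ i ∈ Finset.range n, ∑ j ∈ Finset.range n, (if j < i then g i j else 0) ≤
      ∑ i ∈ Finset.range n, ∑ j ∈ Finset.range n, g i j := by
    rw [← Finset.sum_add_distrib]
    refine Finset.sum_le_sum fun i _ => ?_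
    rw [← Finset.sum_add_distrib]
    refine Finset.sum_le_sum fun j _ => ?_
    have := h0 i j
    split_ifs <;> first | omega | linarith
  rw [Finset.sum_filter, Finset.sum_product]
  linarith

lemma main_ineq (m : ℕ) {V : Type*} [Fintype V] (G : SimpleGraph V)
    (hcard : Fintype.card V = 2*(m+1)+1) (h2 : TwoConnected G) (hnb : ¬ G.Colorable 2) (x : V → ℝ) :
    leastQEig (cycleG (2*(m+1)+1)) * (x ⬝ᵥ x) ≤ x ⬝ᵥ (signlessLaplacian G).mulVec x := by
  obtain ⟨n, hn⟩ : ∃ n, n = 2*(m+1)+1 := ⟨_, rfl⟩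
  have hn0 : 0 < n := by omega
  rw [← hn] at hcard ⊢
  let e : Fin n ≃ V := (Fintype.equivFinOfCardEq hcard).symm
  let s := Tuple.sort (fun i => -|x (e i)|)
  have hmono := Tuple.monotone_sort (fun i => -|x (e i)|)
  let σ : Fin n ≃ V := s.trans e
  have hanti : ∀ i j : Fin n, i ≤ j → |x (σ j)| ≤ |x (σ i)| := by
    intro i j hij
    have := hmono hij
    simp only [Function.comp] at this
    exact neg_le_neg_iff.1 this
  clear_value σ
  clear hmono
  let pos : ℕ → V := fun i => if h : i < n then σ ⟨i, h⟩ else σ ⟨0, hn0⟩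
  have hpos : ∀ i : Fin n, pos i = σ i := by
    intro i; simp [pos, i.2]
  have pinj : ∀ i j, i < n → j < n → pos i = pos j → i = j := by
    intro i j hi hj h
    rw [hpos ⟨i, hi⟩, hpos ⟨j, hj⟩] at h
    simpa using σ.injective h
  have psurj : ∀ v, ∃ i, i < n ∧ pos i = v := by
    intro v
    exact ⟨σ.symm v, (σ.symm v).2, by rw [hpos]; simp⟩
  let a : ℕ → ℝ := fun i => if i < n then |x (pos i)| else 0
  let ε : ℕ → ℝ := fun i => if 0 ≤ x (pos i) then 1 else -1
  have hε : ∀ i, ε i = 1 ∨ ε i = -1 := by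
    intro i; simp only [ε]; split_ifs <;> simp
  have hεa : ∀ i, i < n → ε i * a i = x (pos i) := by
    intro i hi
    simp only [ε, a, if_pos hi]
    split_ifs with h
    · rw [abs_of_nonneg h]; ring
    · rw [abs_of_neg (not_le.1 h)]; ring
  have ha : ∀ i, a (i+1) ≤ a i := by
    intro i
    simp only [a]
    by_cases h : i + 1 < n
    · rw [if_pos h, if_pos (by omega), hpos ⟨i+1, h⟩, hpos ⟨i, by omega⟩]
      exact hanti _ _ (by simp)
    · rw [if_neg h]
      split_ifs <;> positivity
  have sumV : ∀ f : V → ℝ, ∑ v, f v = ∑ i ∈ Finset.range n, f (pos i) := by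
    intro f
    rw [Finset.sum_range, ← Equiv.sum_comp σ]
    simp only [hpos]
  let E : Finset (ℕ × ℕ) := ((Finset.range n ×ˢ Finset.range n).filter (fun p => p.1 < p.2)).filter
    (fun p => G.Adj (pos p.1) (pos p.2))
  have memE : ∀ i j, i < j → j < n → G.Adj (pos i) (pos j) → (i, j) ∈ E := by
    intro i j h1 h2 h3
    simp only [E, Finset.mem_filter, Finset.mem_product, Finset.mem_range]
    exact ⟨⟨⟨by omega, h2⟩, h1⟩, h3⟩
  have key := core (2*m+1) E ε a hε ha (by simp only [a]; rw [if_neg (by omega)])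
    (by
      intro p hp
      simp only [E, Finset.mem_filter, Finset.mem_product, Finset.mem_range] at hp
      omega)
    (by
      intro i hi
      -- generic cut on positions
      have cut : ∀ r < n, ∀ P : ℕ → Prop, ¬ P r → (∃ p < n, P p) → (∃ q < n, ¬ P q ∧ q ≠ r) →
          ∃ u < n, ∃ w < n, P u ∧ ¬ P w ∧ w ≠ r ∧ G.Adj (pos u) (pos w) := by
        rintro r hr P hPr ⟨p, hp, hPp⟩ ⟨q, hq, hPq, hqr⟩
        obtain ⟨u, ⟨u', hu', hPu, rfl⟩, w, hw, hwr, hadj⟩ := cutv G h2 (pos r)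
          {v | ∃ i, i < n ∧ P i ∧ pos i = v}
          (by rintro ⟨i, hi, hPi, h⟩; rw [pinj i r hi hr h] at hPi; exact hPr hPi)
          (pos p) (pos q) ⟨p, hp, hPp, rfl⟩
          (by rintro ⟨i, hi, hPi, h⟩; rw [pinj i q hi hq h] at hPi; exact hPq hPi)
          (fun h => hqr (pinj _ _ hq hr h))
        obtain ⟨w', hw', rfl⟩ := psurj w
        exact ⟨u', hu', w', hw', hPu, fun h => hw ⟨w', hw', h, rfl⟩, fun h => hwr (by rw [h]), hadj⟩
      rcases Nat.eq_zero_or_pos i with rfl | hi0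
      · obtain ⟨u, hu, w, hw, hPu, hPw, hwr, hadj⟩ := cut 1 (by omega) (fun j => j = 0) (by simp)
          ⟨0, hn0, rfl⟩ ⟨2, by omega, by simp, by simp⟩
        subst hPu
        obtain ⟨u', hu', w', hw', hPu', hPw', hwr', hadj'⟩ := cut w hw (fun j => j = 0) hPw
          ⟨0, hn0, rfl⟩ ⟨1, by omega, by simp, by omega⟩
        subst hPu'
        refine ⟨(0, w), memE _ _ (by omega) hw hadj, (0, w'), memE _ _ (by omega) hw' hadj', ?_, ?_⟩
        · intro h; simp at h; exact hwr' h.symm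
        · refine ⟨le_rfl, ?_, le_rfl, ?_⟩ <;> simp only <;> omega
      · obtain ⟨u, hu, w, hw, hPu, hPw, hwr, hadj⟩ := cut 0 (by omega) (fun j => 0 < j ∧ j ≤ i) (by simp)
          ⟨1, by omega, by omega⟩ ⟨i+1, by omega, by omega, by omega⟩
        obtain ⟨u', hu', w', hw', hPu', hPw', hwr', hadj'⟩ := cut u hu (fun j => j ≠ u ∧ j ≤ i)
          (by simp) ⟨0, hn0, by omega⟩ ⟨i+1, by omega, by omega, by omega⟩
        refine ⟨(u, w), memE _ _ (by omega) hw hadj, (u', w'), memE _ _ (by omega) hw' hadj', ?_, ?_⟩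
        · intro h; simp at h; exact hPu'.1 h.1.symm
        · refine ⟨?_, ?_, ?_, ?_⟩ <;> simp only <;> omega)
    (by
      intro i hi
      obtain ⟨u, ⟨u', hu', hPu, rfl⟩, w, hw, hwr, hadj⟩ := cutv G h2 (pos (i+1))
          {v | ∃ j, j < n ∧ j ≤ i ∧ pos j = v}
          (by
            rintro ⟨j, hj, hPj, h⟩
            have := pinj j (i+1) hj (by omega) h
            omega)
          (pos 0) (pos (i+2)) ⟨0, by omega, by omega, rfl⟩
          (by
            rintro ⟨j, hj, hPj, h⟩
            have := pinj j (i+2) hj (by omega) h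
            omega)
          (fun h => by
            have := pinj _ _ (by omega) (by omega) h
            omega)
      obtain ⟨w', hw', rfl⟩ := psurj w
      have h1 : ¬ w' ≤ i := fun h => hw ⟨w', hw', h, rfl⟩
      have h3 : w' ≠ i + 1 := fun h => hwr (by rw [h])
      refine ⟨(u', w'), memE _ _ (by omega) hw' hadj, hPu, ?_⟩
      simp only; omega)
    (by
      by_contra! hcon
      apply hnb
      have hcol : ∀ u v, G.Adj u v → (decide (0 ≤ x u)) ≠ (decide (0 ≤ x v)) := by
        have aux : ∀ i j, i < j → j < n → G.Adj (pos i) (pos j) →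
            (decide (0 ≤ x (pos i))) ≠ (decide (0 ≤ x (pos j))) := by
          intro i j hij hj hadj h
          apply hcon (i, j) (memE i j hij hj hadj) hij
          simp only [decide_eq_decide] at h
          simp only [ε, h]
        intro u v huv
        obtain ⟨i, hi, rfl⟩ := psurj u
        obtain ⟨j, hj, rfl⟩ := psurj v
        rcases lt_trichotomy i j with h | h | h
        · exact aux i j h hj huv
        · subst h; exact absurd huv (G.irrefl)
        · exact (aux j i h hi huv.symm).symm
      have := (SimpleGraph.Coloring.mk (G := G) (fun v => decide (0 ≤ x v)) (fun {u v} h => hcol u v h)).colorable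
      simpa using this)
  rw [quadQ G x]
  have hF : ∑ p ∈ E, (ε p.1 * a p.1 + ε p.2 * a p.2)^2 ≤
      (1/2) * ∑ u, ∑ v, if G.Adj u v then (x u + x v)^2 else 0 := by
    have := half_sum n (fun i j => if G.Adj (pos i) (pos j) then (x (pos i) + x (pos j))^2 else 0)
      (by
        intro i j
        simp only [G.adj_comm (pos i) (pos j), add_comm (x (pos i))])
      (by intro i j; split_ifs <;> positivity)
    rw [sumV]
    simp only [sumV]
    refine le_trans (le_of_eq ?_) this
    simp only [E]
    rw [Finset.sum_filter]
    refine Finset.sum_congr rfl fun p hp => ?_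
    simp only [Finset.mem_filter, Finset.mem_product, Finset.mem_range] at hp
    rw [hεa _ hp.1.1, hεa _ hp.1.2]
  refine le_trans ?_ (key.trans hF)
  have hr := rayleigh (cycleG n) (fun i => wseq (m+1) a i)
  rw [quadQ] at hr
  have hc := hr.trans (cycle_form n (by omega) (wseq (m+1) a) (by rw [hn]; exact wper _ _))
  have hwf := wform m a
  have hws := wsum (m+1) a
  rw [← hn] at hwf hws
  rw [hwf] at hc
  have hnorm : (fun i : Fin n => wseq (m+1) a i) ⬝ᵥ (fun i : Fin n => wseq (m+1) a i) = x ⬝ᵥ x := by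
    simp only [dotProduct]
    rw [sumV, ← Finset.sum_range (fun i => wseq (m+1) a i * wseq (m+1) a i)]
    simp only [← sq]
    rw [hws]
    refine Finset.sum_congr rfl fun i hi => ?_
    rw [Finset.mem_range] at hi
    simp only [a, if_pos hi, sq_abs]
  rw [hnorm] at hc
  exact hc


theorem stmt8 (n : ℕ) (hn : 3 ≤ n) (hodd : Odd n) {V : Type*} [Fintype V]
    (G : SimpleGraph V) (hcard : Fintype.card V = n)
    (h2 : TwoConnected G) (hnb : ¬ G.Colorable 2) :
    leastQEig (cycleG n) ≤ leastQEig G := by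
  obtain ⟨k, rfl⟩ := hodd
  obtain ⟨m, rfl⟩ : ∃ m, k = m + 1 := ⟨k - 1, by omega⟩
  have : Nonempty V := Fintype.card_pos_iff.1 (by omega)
  refine le_csInf (nonempty_Q G) ?_
  rintro μ ⟨x, hx, h⟩
  have h1 := main_ineq m G hcard h2 hnb x
  rw [h, dotProduct_smul, smul_eq_mul] at h1
  exact le_of_mul_le_mul_right h1 (dot_pos x hx)
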